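/- arXiv:1702.04190 — 2 statements merged into one kernel-verified Lean document; each statement's English description precedes it below -/
import Mathlib

section
/- Let $f:\mathbb{R}\to\mathbb{R}$ be locally integrable, let $x_0\in\mathbb{R}$, $\delta>0$ and $\varepsilon>0$, and suppose $\int_{x_0}^{x_0+h}|f(t)-f(x_0)|\,dt\leq\varepsilon h$ for all $0<h\leq\delta$. Let $K:[x_0,x_0+\delta]\to\mathbb{R}$ be nonnegative, nonincreasing, and integrable on $[x_0,x_0+\delta]$. Then $\int_{x_0}^{x_0+\delta}|f(t)-f(x_0)|\,K(t)\,dt\leq\varepsilon\int_{x_0}^{x_0+\delta}K(t)\,dt$. -/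
open MeasureTheory Set

/-- A measure that is dominated by `ν` on initial intervals of `Ioc a b` is dominated by `ν` on the
superlevel sets of antitone functions. -/
theorem measure_superlevel_le_of_antitoneOn {μ ν : Measure ℝ} {a b : ℝ} {K : ℝ → ℝ}
    (hμ : ∀ᵐ t ∂μ, t ∈ Ioc a b) (hK : AntitoneOn K (Icc a b))
    (h : ∀ c ∈ Ioc a b, μ (Ioc a c) ≤ ν (Ioo a c)) (s : ℝ) :
    μ {t | s < K t} ≤ ν {t | s < K t} := by
  rcases ({t | s < K t} ∩ Ioc a b).eq_empty_or_nonempty with hT | ⟨u, hu⟩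
  · have h_null : μ {t | s < K t} ≤ μ ∅ := by
      apply measure_mono_ae
      filter_upwards [hμ] with t ht hst
      have : t ∈ {t | s < K t} ∩ Ioc a b := ⟨hst, ht⟩
      rwa [hT] at this
    exact h_null.trans (by simp)
  · set T := {t | s < K t} ∩ Ioc a b
    have hbdd : BddAbove T := ⟨b, fun t ht => ht.2.2⟩
    have hc : sSup T ∈ Ioc a b :=
      ⟨hu.2.1.trans_le (le_csSup hbdd hu), csSup_le ⟨u, hu⟩ fun t ht => ht.2.2⟩
    calc μ {t | s < K t} ≤ μ (Ioc a (sSup T)) := by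
          apply measure_mono_ae
          filter_upwards [hμ] with t ht hst
          exact ⟨ht.1, le_csSup hbdd ⟨hst, ht⟩⟩
      _ ≤ ν (Ioo a (sSup T)) := h _ hc
      _ ≤ ν {t | s < K t} := by
          apply measure_mono
          intro t ht
          obtain ⟨v, hv, htv⟩ := exists_lt_of_lt_csSup ⟨u, hu⟩ ht.2
          exact lt_of_lt_of_le hv.1 (hK ⟨ht.1.le, htv.le.trans hv.2.2⟩
            ⟨hv.2.1.le, hv.2.2⟩ htv.le)

/-- The right-hand local estimate (7): if `∫_{x₀}^{x₀+h} |f - f(x₀)| ≤ ε h` for all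
`0 < h ≤ δ` and `K` is nonnegative and nonincreasing on `[x₀, x₀+δ]`, then
`∫_{x₀}^{x₀+δ} |f(t) - f(x₀)| K(t) dt ≤ ε ∫_{x₀}^{x₀+δ} K(t) dt`. -/
theorem local_estimate_right
    (f : ℝ → ℝ) (hf : LocallyIntegrable f)
    (x₀ δ ε : ℝ) (hδ : 0 < δ) (hε : 0 < ε)
    (hLeb : ∀ h : ℝ, 0 < h → h ≤ δ →
      (∫ t in x₀..(x₀ + h), |f t - f x₀|) ≤ ε * h)
    (K : ℝ → ℝ)
    (hKnonneg : ∀ t ∈ Set.Icc x₀ (x₀ + δ), 0 ≤ K t)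
    (hKanti : AntitoneOn K (Set.Icc x₀ (x₀ + δ)))
    (hKint : IntegrableOn K (Set.Icc x₀ (x₀ + δ))) :
    (∫ t in x₀..(x₀ + δ), |f t - f x₀| * K t) ≤
      ε * ∫ t in x₀..(x₀ + δ), K t := by
  have hle : x₀ ≤ x₀ + δ := by linarith
  set ρ := volume.restrict (Ioc x₀ (x₀ + δ)) with hρ
  have hg : LocallyIntegrable fun t => |f t - f x₀| := fun x =>
    let ⟨s, hs, hi⟩ := hf.sub (locallyIntegrable_const (f x₀)) x
    ⟨s, hs, hi.abs⟩
  have hgm : AEMeasurable (fun t => ENNReal.ofReal |f t - f x₀|) ρ :=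
    hg.aestronglyMeasurable.aemeasurable.ennreal_ofReal.restrict
  set μ := ρ.withDensity fun t => ENNReal.ofReal |f t - f x₀| with hμ
  have hac : μ ≪ ρ := withDensity_absolutelyContinuous _ _
  have hmem : ∀ᵐ t ∂ρ, t ∈ Ioc x₀ (x₀ + δ) := ae_restrict_mem measurableSet_Ioc
  have hK0 : ∀ᵐ t ∂ρ, 0 ≤ K t := hmem.mono fun t ht => hKnonneg t (Ioc_subset_Icc_self ht)
  have hKi : Integrable K ρ := hKint.mono_set Ioc_subset_Icc_self
  have hKm : AEMeasurable K ρ := hKi.aestronglyMeasurable.aemeasurable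
  have hinit : ∀ c ∈ Ioc x₀ (x₀ + δ),
      μ (Ioc x₀ c) ≤ (ENNReal.ofReal ε • ρ) (Ioo x₀ c) := by
    intro c hc
    have hsub : Ioc x₀ c ⊆ Ioc x₀ (x₀ + δ) := Ioc_subset_Ioc_right hc.2
    have hgi : IntegrableOn (fun t => |f t - f x₀|) (Ioc x₀ c) :=
      (hg.integrableOn_isCompact isCompact_Icc).mono_set Ioc_subset_Icc_self
    have hint := hLeb (c - x₀) (by linarith [hc.1]) (by linarith [hc.2])
    rw [add_sub_cancel, intervalIntegral.integral_of_le hc.1.le] at hint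
    rw [hμ, withDensity_apply _ measurableSet_Ioc, hρ,
      Measure.restrict_restrict measurableSet_Ioc, inter_eq_left.mpr hsub,
      ← ofReal_integral_eq_lintegral_ofReal hgi (ae_of_all _ fun t => abs_nonneg _),
      Measure.smul_apply, Measure.restrict_apply measurableSet_Ioo,
      inter_eq_left.mpr (Ioo_subset_Ioc_self.trans hsub), Real.volume_Ioo, smul_eq_mul,
      ← ENNReal.ofReal_mul hε.le]
    exact ENNReal.ofReal_le_ofReal hint
  have key : ∫⁻ t, ENNReal.ofReal (K t) ∂μ ≤
      ∫⁻ t, ENNReal.ofReal (K t) ∂(ENNReal.ofReal ε • ρ) := by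
    rw [lintegral_eq_lintegral_meas_lt μ (hac.ae_le hK0) (hKm.mono_ac hac),
      lintegral_eq_lintegral_meas_lt (ENNReal.ofReal ε • ρ)
        (Measure.smul_absolutelyContinuous.ae_le hK0)
        (hKm.mono_ac Measure.smul_absolutelyContinuous)]
    exact lintegral_mono fun s =>
      measure_superlevel_le_of_antitoneOn (hac.ae_le hmem) hKanti hinit s
  rw [lintegral_smul_measure, smul_eq_mul,
    lintegral_withDensity_eq_lintegral_mul₀ hgm hKm.ennreal_ofReal,
    ← ofReal_integral_eq_lintegral_ofReal hKi hK0, ← ENNReal.ofReal_mul hε.le] at key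
  rw [intervalIntegral.integral_of_le hle, intervalIntegral.integral_of_le hle,
    integral_eq_lintegral_of_nonneg_ae
      (hK0.mono fun t ht => mul_nonneg (abs_nonneg _) ht)
      (hg.aestronglyMeasurable.restrict.mul hKi.aestronglyMeasurable)]
  refine ENNReal.toReal_le_of_le_ofReal
    (mul_nonneg hε.le (integral_nonneg_of_ae hK0)) (le_trans (le_of_eq ?_) key)
  simp only [Pi.mul_apply, ENNReal.ofReal_mul (abs_nonneg _), hρ]
end

section
/- Let $f:\mathbb{R}\to\mathbb{R}$ be locally integrable, let $x_0\in\mathbb{R}$, $\delta>0$ and $\varepsilon>0$, and suppose $\int_{x_0-h}^{x_0}|f(t)-f(x_0)|\,dt\leq\varepsilon h$ for all $0<h\leq\delta$. Let $K:[x_0-\delta,x_0]\to\mathbb{R}$ be nonnegative, nondecreasing, and integrable on $[x_0-\delta,x_0]$. Then $\int_{x_0-\delta}^{x_0}|f(t)-f(x_0)|\,K(t)\,dt\leq\varepsilon\int_{x_0-\delta}^{x_0}K(t)\,dt$. -/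
open MeasureTheory Set

/-- If `g` and `c` satisfy `∫⁻ g ≤ c * (b - y)` on every right-anchored interval `(y, b]`, then the
same comparison holds on the superlevel sets of a function monotone on `(a, b]`. -/
theorem setLIntegral_superlevel_le {g : ℝ → ENNReal} {c : ENNReal} {a b : ℝ}
    (hg : ∀ y, a ≤ y → y ≤ b → ∫⁻ t in Ioc y b, g t ≤ c * volume (Ioc y b))
    {K : ℝ → ℝ} (hK : MonotoneOn K (Ioc a b)) (s : ℝ) :
    ∫⁻ t in {t | s < K t} ∩ Ioc a b, g t ≤ c * volume ({t | s < K t} ∩ Ioc a b) := by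
  set A := {t | s < K t} ∩ Ioc a b with hA
  rcases A.eq_empty_or_nonempty with h | hne
  · simp [h]
  have hbdd : BddBelow A := ⟨a, fun t ht => ht.2.1.le⟩
  have hay : a ≤ sInf A := le_csInf hne fun t ht => ht.2.1.le
  have hyb : sInf A ≤ b := by
    obtain ⟨t, ht⟩ := hne
    exact (csInf_le hbdd ht).trans ht.2.2
  have hsub : A ⊆ Icc (sInf A) b := fun t ht => ⟨csInf_le hbdd ht, ht.2.2⟩
  have hsup : Ioc (sInf A) b ⊆ A := by
    intro t ht
    obtain ⟨u, hu, hut⟩ := exists_lt_of_csInf_lt hne ht.1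
    have htI : t ∈ Ioc a b := ⟨hay.trans_lt ht.1, ht.2⟩
    exact ⟨lt_of_lt_of_le hu.1 (hK hu.2 htI hut.le), htI⟩
  calc ∫⁻ t in A, g t ≤ ∫⁻ t in Icc (sInf A) b, g t := lintegral_mono_set hsub
    _ = ∫⁻ t in Ioc (sInf A) b, g t := by rw [restrict_Ioc_eq_restrict_Icc]
    _ ≤ c * volume (Ioc (sInf A) b) := hg _ hay hyb
    _ ≤ c * volume A := by gcongr

/-- Comparison on right-anchored intervals passes to integrals against a nonnegative
nondecreasing weight. -/
theorem setLIntegral_mul_ofReal_le_of_monotoneOn {g : ℝ → ENNReal} {c : ENNReal} {a b : ℝ}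
    (hgm : AEMeasurable g (volume.restrict (Ioc a b)))
    (hg : ∀ y, a ≤ y → y ≤ b → ∫⁻ t in Ioc y b, g t ≤ c * volume (Ioc y b))
    {K : ℝ → ℝ} (hK : MonotoneOn K (Ioc a b)) (hK0 : ∀ t ∈ Ioc a b, 0 ≤ K t) :
    ∫⁻ t in Ioc a b, g t * ENNReal.ofReal (K t) ≤
      c * ∫⁻ t in Ioc a b, ENNReal.ofReal (K t) := by
  have hKm : AEMeasurable K (volume.restrict (Ioc a b)) :=
    aemeasurable_restrict_of_monotoneOn measurableSet_Ioc hK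
  have hK0' : 0 ≤ᵐ[volume.restrict (Ioc a b)] K :=
    (ae_restrict_iff' measurableSet_Ioc).2 (Filter.Eventually.of_forall hK0)
  have hac := withDensity_absolutelyContinuous (volume.restrict (Ioc a b)) g
  have hnull (s : ℝ) : NullMeasurableSet {t | s < K t} (volume.restrict (Ioc a b)) :=
    nullMeasurableSet_lt aemeasurable_const hKm
  calc ∫⁻ t in Ioc a b, g t * ENNReal.ofReal (K t)
      = ∫⁻ t, ENNReal.ofReal (K t) ∂(volume.restrict (Ioc a b)).withDensity g :=
        (lintegral_withDensity_eq_lintegral_mul₀ hgm hKm.ennreal_ofReal).symm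
    _ = ∫⁻ s in Ioi 0, (volume.restrict (Ioc a b)).withDensity g {t | s < K t} :=
        lintegral_eq_lintegral_meas_lt _ (hac.ae_le hK0') (hKm.mono_ac hac)
    _ ≤ ∫⁻ s in Ioi 0, c * volume.restrict (Ioc a b) {t | s < K t} := by
        refine lintegral_mono fun s => ?_
        rw [withDensity_apply₀ _ (hnull s), Measure.restrict_restrict₀ (hnull s),
          Measure.restrict_apply' measurableSet_Ioc]
        exact setLIntegral_superlevel_le hg hK s
    _ = c * ∫⁻ s in Ioi 0, volume.restrict (Ioc a b) {t | s < K t} := by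
        refine lintegral_const_mul _ (Antitone.measurable fun s s' h => ?_)
        exact measure_mono fun t (ht : s' < K t) => h.trans_lt ht
    _ = c * ∫⁻ t in Ioc a b, ENNReal.ofReal (K t) := by
        rw [lintegral_eq_lintegral_meas_lt _ hK0' hKm]

/-- The left-hand local estimate (8): if `∫_{x₀-h}^{x₀} |f - f(x₀)| ≤ ε h` for all
`0 < h ≤ δ` and `K` is nonnegative and nondecreasing on `[x₀-δ, x₀]`, then
`∫_{x₀-δ}^{x₀} |f(t) - f(x₀)| K(t) dt ≤ ε ∫_{x₀-δ}^{x₀} K(t) dt`. -/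
theorem local_estimate_left
    (f : ℝ → ℝ) (hf : LocallyIntegrable f)
    (x₀ δ ε : ℝ) (hδ : 0 < δ) (hε : 0 < ε)
    (hLeb : ∀ h : ℝ, 0 < h → h ≤ δ →
      (∫ t in (x₀ - h)..x₀, |f t - f x₀|) ≤ ε * h)
    (K : ℝ → ℝ)
    (hKnonneg : ∀ t ∈ Set.Icc (x₀ - δ) x₀, 0 ≤ K t)
    (hKmono : MonotoneOn K (Set.Icc (x₀ - δ) x₀))
    (hKint : IntegrableOn K (Set.Icc (x₀ - δ) x₀)) :
    (∫ t in (x₀ - δ)..x₀, |f t - f x₀| * K t) ≤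
      ε * ∫ t in (x₀ - δ)..x₀, K t := by
  have hg : LocallyIntegrable fun t => |f t - f x₀| := fun x => by
    obtain ⟨s, hs, hint⟩ := hf.sub (locallyIntegrable_const (f x₀)) x
    exact ⟨s, hs, hint.abs⟩
  have hgI (y : ℝ) : IntegrableOn (fun t => |f t - f x₀|) (Ioc y x₀) :=
    (hg.integrableOn_isCompact isCompact_Icc).mono_set Ioc_subset_Icc_self
  have hKI : IntegrableOn K (Ioc (x₀ - δ) x₀) := hKint.mono_set Ioc_subset_Icc_self
  have hK0 : ∀ t ∈ Ioc (x₀ - δ) x₀, 0 ≤ K t := fun t ht => hKnonneg t (Ioc_subset_Icc_self ht)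
  have hK0' : 0 ≤ᵐ[volume.restrict (Ioc (x₀ - δ) x₀)] K :=
    (ae_restrict_iff' measurableSet_Ioc).2 (Filter.Eventually.of_forall hK0)
  have hanchored (y : ℝ) (hay : x₀ - δ ≤ y) (hyb : y ≤ x₀) :
      ∫⁻ t in Ioc y x₀, ENNReal.ofReal |f t - f x₀| ≤
        ENNReal.ofReal ε * volume (Ioc y x₀) := by
    rcases hyb.eq_or_lt with rfl | hlt
    · simp
    rw [← ofReal_integral_eq_lintegral_ofReal (hgI y)
      (Filter.Eventually.of_forall fun t => abs_nonneg _), Real.volume_Ioc,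
      ← ENNReal.ofReal_mul hε.le, ← intervalIntegral.integral_of_le hyb]
    have h := hLeb (x₀ - y) (by linarith) (by linarith)
    rw [sub_sub_cancel] at h
    exact ENNReal.ofReal_le_ofReal h
  have key := setLIntegral_mul_ofReal_le_of_monotoneOn
    (hgI (x₀ - δ)).aestronglyMeasurable.aemeasurable.ennreal_ofReal hanchored
    (hKmono.mono Ioc_subset_Icc_self) hK0
  have hle : x₀ - δ ≤ x₀ := by linarith
  have hKint0 : 0 ≤ ∫ t in Ioc (x₀ - δ) x₀, K t := integral_nonneg_of_ae hK0'
  rw [intervalIntegral.integral_of_le hle, intervalIntegral.integral_of_le hle,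
    integral_eq_lintegral_of_nonneg_ae
      (hK0'.mono fun t (ht : 0 ≤ K t) => mul_nonneg (abs_nonneg _) ht)
      ((hgI (x₀ - δ)).aestronglyMeasurable.mul hKI.aestronglyMeasurable)]
  refine ENNReal.toReal_le_of_le_ofReal (mul_nonneg hε.le hKint0) ?_
  rw [ENNReal.ofReal_mul hε.le, ofReal_integral_eq_lintegral_ofReal hKI hK0']
  simpa only [ENNReal.ofReal_mul (abs_nonneg _)] using key
end
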